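/- Let f : ℝ^n → ℝ ∪ {+∞} be μ_f-strongly convex proper closed, g : ℝ^m → ℝ ∪ {+∞} proper closed convex, A ∈ ℝ^{m×n}; suppose a primal-dual solution pair of minimize_x f(x)+g(Ax) exists and z ↦ g*(z) + f*(−A^T z) is coercive. Let M1, M2 be symmetric positive definite and c > 0 satisfy C1 = ½M1^{-1} − (‖M1‖/μ_f²)I_n ≻ 0 and C2 = M2 − ½AM1^{-1}A^T − c I_m ≻ 0. Let (x^k, z^k) be generated by inexact PrePDHG: x^{k+1} = prox^{M1}_f(x^k − M1^{-1}A^T z^k), and z^{k+1} satisfies 0 ∈ ∂g*(z^{k+1}) + M2(z^{k+1} − z^k − M2^{-1}A(2x^{k+1} − x^k)) + ε^{k+1} with ‖ε^{k+1}‖ ≤ c‖z^{k+1} − z^k‖. Then the sequence (x^k, z^k) is bounded, and every cluster point of {(x^k, z^k)} is a primal-dual solution pair of minimize_x f(x)+g(Ax), i.e., satisfies −A^T z ∈ ∂f(x) and Ax ∈ ∂g*(z). -/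

import Mathlib

open Matrix Filter

noncomputable section

/-- Euclidean norm of a vector. -/
def nrm {ι : Type*} [Fintype ι] (x : ι → ℝ) : ℝ := Real.sqrt (x ⬝ᵥ x)

/-- A function into the extended reals is proper: never `⊥` and somewhere finite. -/
def ProperE {ι : Type*} (f : (ι → ℝ) → EReal) : Prop :=
  (∃ x, f x ≠ ⊤) ∧ ∀ x, f x ≠ ⊥

/-- Convexity of an extended-real-valued function. -/
def ConvexE {ι : Type*} (f : (ι → ℝ) → EReal) : Prop :=
  ∀ x y : ι → ℝ, ∀ t : ℝ, 0 ≤ t → t ≤ 1 →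
    f (t • x + (1 - t) • y) ≤ (t : EReal) * f x + ((1 - t : ℝ) : EReal) * f y

/-- `μ`-strong convexity of an extended-real-valued function. -/
def StrongConvexE {ι : Type*} [Fintype ι] (μ : ℝ) (f : (ι → ℝ) → EReal) : Prop :=
  ∀ x y : ι → ℝ, ∀ t : ℝ, 0 ≤ t → t ≤ 1 →
    f (t • x + (1 - t) • y) + ((μ / 2 * (t * (1 - t)) * ((x - y) ⬝ᵥ (x - y)) : ℝ) : EReal) ≤
      (t : EReal) * f x + ((1 - t : ℝ) : EReal) * f y

/-- Fenchel conjugate. -/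
def conjE {ι : Type*} [Fintype ι] (f : (ι → ℝ) → EReal) (y : ι → ℝ) : EReal :=
  ⨆ x : ι → ℝ, ((x ⬝ᵥ y : ℝ) : EReal) - f x

/-- `v` is a subgradient of `f` at `x`. -/
def SubgradAt {ι : Type*} [Fintype ι] (f : (ι → ℝ) → EReal) (x v : ι → ℝ) : Prop :=
  ∀ z, f x + (((z - x) ⬝ᵥ v : ℝ) : EReal) ≤ f z

/-- `p = prox^M_φ(x)`: `p` minimizes `φ(·) + ½‖· − x‖²_M`. -/
def IsProxPt {ι : Type*} [Fintype ι] (M : Matrix ι ι ℝ) (φ : (ι → ℝ) → EReal)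
    (x p : ι → ℝ) : Prop :=
  ∀ w, φ p + (((1 / 2 : ℝ) * ((p - x) ⬝ᵥ M.mulVec (p - x)) : ℝ) : EReal) ≤
       φ w + (((1 / 2 : ℝ) * ((w - x) ⬝ᵥ M.mulVec (w - x)) : ℝ) : EReal)

/-- Smallest eigenvalue of a symmetric matrix, via the Rayleigh quotient. -/
def lamMin {ι : Type*} [Fintype ι] (M : Matrix ι ι ℝ) : ℝ :=
  sInf {r | ∃ v : ι → ℝ, v ⬝ᵥ v = 1 ∧ r = v ⬝ᵥ M.mulVec v}

/-- Largest eigenvalue of a symmetric matrix, via the Rayleigh quotient. -/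
def lamMax {ι : Type*} [Fintype ι] (M : Matrix ι ι ℝ) : ℝ :=
  sSup {r | ∃ v : ι → ℝ, v ⬝ᵥ v = 1 ∧ r = v ⬝ᵥ M.mulVec v}

/-- Spectral (operator 2-) norm of a matrix. -/
def specNorm {ι κ : Type*} [Fintype ι] [Fintype κ] (A : Matrix ι κ ℝ) : ℝ :=
  sSup {r | ∃ v : κ → ℝ, v ⬝ᵥ v = 1 ∧ r = nrm (A.mulVec v)}

section QuadraticForms

variable {ι κ : Type*} [Fintype ι] [Fintype κ]

lemma nrm_eq_norm (v : ι → ℝ) : nrm v = ‖WithLp.toLp 2 v‖ := by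
  rw [nrm, EuclideanSpace.norm_eq]
  congr 1
  exact Finset.sum_congr rfl fun i _ => by simp [sq]

lemma nrm_nonneg (v : ι → ℝ) : 0 ≤ nrm v := Real.sqrt_nonneg _

lemma dotProduct_self_nonneg' (v : ι → ℝ) : 0 ≤ v ⬝ᵥ v :=
  Finset.sum_nonneg fun i _ => mul_self_nonneg (v i)

lemma nrm_sq (v : ι → ℝ) : nrm v ^ 2 = v ⬝ᵥ v :=
  Real.sq_sqrt (dotProduct_self_nonneg' v)

lemma nrm_add_le (v w : ι → ℝ) : nrm (v + w) ≤ nrm v + nrm w := by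
  simp only [nrm_eq_norm, WithLp.toLp_add]
  exact norm_add_le _ _

lemma nrm_neg (v : ι → ℝ) : nrm (-v) = nrm v := by
  simp [nrm]

lemma nrm_smul (a : ℝ) (v : ι → ℝ) : nrm (a • v) = |a| * nrm v := by
  simp [nrm_eq_norm, norm_smul]

lemma nrm_sub_le (v w : ι → ℝ) : nrm (v - w) ≤ nrm v + nrm w := by
  simpa [sub_eq_add_neg, nrm_neg] using nrm_add_le v (-w)

lemma dotProduct_le_nrm_mul_nrm (v w : ι → ℝ) : v ⬝ᵥ w ≤ nrm v * nrm w := by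
  rw [nrm, nrm, ← Real.sqrt_mul (dotProduct_self_nonneg' v)]
  refine Real.le_sqrt_of_sq_le ?_
  simpa [dotProduct, sq] using Finset.sum_mul_sq_le_sq_mul_sq Finset.univ v w

lemma abs_apply_le_nrm (v : ι → ℝ) (i : ι) : |v i| ≤ nrm v := by
  rw [nrm_eq_norm]
  exact PiLp.norm_apply_le (WithLp.toLp 2 v) i

lemma nrm_eq_zero {v : ι → ℝ} (h : nrm v = 0) : v = 0 := by
  funext i
  exact abs_nonpos_iff.mp (h ▸ abs_apply_le_nrm v i)

lemma exists_nrm_mulVec_le (M : Matrix ι κ ℝ) :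
    ∃ K, 0 ≤ K ∧ ∀ v, nrm (M *ᵥ v) ≤ K * nrm v := by
  classical
  refine ⟨‖(Matrix.toEuclideanLin M).toContinuousLinearMap‖, norm_nonneg _, fun v => ?_⟩
  have := (Matrix.toEuclideanLin M).toContinuousLinearMap.le_opNorm (WithLp.toLp 2 v)
  simpa [nrm_eq_norm, Matrix.toLpLin_apply] using this

lemma specNorm_nonneg (M : Matrix ι κ ℝ) : 0 ≤ specNorm M := by
  refine Real.sSup_nonneg ?_
  rintro r ⟨v, -, rfl⟩
  exact nrm_nonneg _

lemma nrm_mulVec_le_specNorm (M : Matrix ι κ ℝ) (v : κ → ℝ) :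
    nrm (M *ᵥ v) ≤ specNorm M * nrm v := by
  obtain ⟨K, hK0, hK⟩ := exists_nrm_mulVec_le M
  rcases (nrm_nonneg v).eq_or_lt with h | h
  · rw [nrm_eq_zero h.symm]
    simp [nrm]
  have hb : BddAbove {r | ∃ v : κ → ℝ, v ⬝ᵥ v = 1 ∧ r = nrm (M *ᵥ v)} := by
    refine ⟨K, ?_⟩
    rintro r ⟨w, hw, rfl⟩
    simpa [nrm, hw] using hK w
  have hmem : nrm (M *ᵥ ((nrm v)⁻¹ • v)) ≤ specNorm M := by
    refine le_csSup hb ⟨_, ?_, rfl⟩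
    simp only [smul_dotProduct, dotProduct_smul, smul_eq_mul, ← nrm_sq]
    field_simp
  rw [mulVec_smul, nrm_smul, abs_of_pos (inv_pos.mpr h)] at hmem
  rwa [inv_mul_le_iff₀ h, mul_comm] at hmem

lemma dotProduct_mulVec_le_specNorm (M : Matrix ι ι ℝ) (v : ι → ℝ) :
    v ⬝ᵥ M *ᵥ v ≤ specNorm M * (v ⬝ᵥ v) := by
  have h1 := dotProduct_le_nrm_mul_nrm v (M *ᵥ v)
  have h2 := mul_le_mul_of_nonneg_left (nrm_mulVec_le_specNorm M v) (nrm_nonneg v)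
  rw [← nrm_sq]
  linarith

lemma Matrix.PosDef.dotProduct_mulVec_comm_real {M : Matrix ι ι ℝ} (hM : M.PosDef)
    (v w : ι → ℝ) : v ⬝ᵥ M *ᵥ w = w ⬝ᵥ M *ᵥ v := by
  have h : Mᵀ = M := by simpa using hM.isHermitian.eq
  rw [dotProduct_comm v, dotProduct_mulVec w, ← mulVec_transpose, h]

lemma Matrix.PosDef.dotProduct_mulVec_nonneg_real {M : Matrix ι ι ℝ} (hM : M.PosDef)
    (v : ι → ℝ) : 0 ≤ v ⬝ᵥ M *ᵥ v := by
  simpa using hM.posSemidef.dotProduct_mulVec_nonneg v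

lemma Matrix.PosDef.mulVec_dotProduct_mulVec_le {M : Matrix ι ι ℝ} (hM : M.PosDef)
    (w : ι → ℝ) : (M *ᵥ w) ⬝ᵥ (M *ᵥ w) ≤ specNorm M * (w ⬝ᵥ M *ᵥ w) := by
  have hq := hM.dotProduct_mulVec_nonneg_real w
  rcases (specNorm_nonneg M).eq_or_lt with h | h
  · have h1 := nrm_mulVec_le_specNorm M w
    rw [← h, zero_mul] at h1
    rw [← h, zero_mul, ← nrm_sq, le_antisymm h1 (nrm_nonneg _)]
    norm_num
  · have h0 := hM.dotProduct_mulVec_nonneg_real (specNorm M • w - M *ᵥ w)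
    have h2 := dotProduct_mulVec_le_specNorm M (M *ᵥ w)
    have h3 := hM.dotProduct_mulVec_comm_real w (M *ᵥ w)
    simp only [mulVec_sub, mulVec_smul, sub_dotProduct, dotProduct_sub, smul_dotProduct,
      dotProduct_smul, smul_eq_mul, h3] at h0
    refine le_of_mul_le_mul_left (a := specNorm M) ?_ h
    nlinarith

lemma Matrix.PosDef.mulVec_inv_mulVec [DecidableEq ι] {M : Matrix ι ι ℝ} (hM : M.PosDef)
    (v : ι → ℝ) : M *ᵥ (M⁻¹ *ᵥ v) = v := by
  rw [mulVec_mulVec, mul_nonsing_inv _ ((isUnit_iff_isUnit_det _).mp hM.isUnit), one_mulVec]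

lemma Matrix.PosDef.inv_mulVec_mulVec [DecidableEq ι] {M : Matrix ι ι ℝ} (hM : M.PosDef)
    (v : ι → ℝ) : M⁻¹ *ᵥ (M *ᵥ v) = v := by
  rw [mulVec_mulVec, nonsing_inv_mul _ ((isUnit_iff_isUnit_det _).mp hM.isUnit), one_mulVec]

lemma Matrix.PosDef.exists_pos_mul_le {M : Matrix ι ι ℝ} (hM : M.PosDef) :
    ∃ δ, 0 < δ ∧ ∀ v, δ * (v ⬝ᵥ v) ≤ v ⬝ᵥ M *ᵥ v := by
  classical
  obtain ⟨K, hK0, hK⟩ := exists_nrm_mulVec_le M⁻¹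
  have hs := specNorm_nonneg M
  refine ⟨(K ^ 2 * specNorm M + 1)⁻¹, by positivity, fun v => ?_⟩
  have h1 := hK (M *ᵥ v)
  rw [hM.inv_mulVec_mulVec] at h1
  have h2 := pow_le_pow_left₀ (nrm_nonneg v) h1 2
  rw [mul_pow, nrm_sq, nrm_sq] at h2
  have h3 := mul_le_mul_of_nonneg_left (hM.mulVec_dotProduct_mulVec_le v) (sq_nonneg K)
  have h4 := hM.dotProduct_mulVec_nonneg_real v
  rw [inv_mul_le_iff₀ (by positivity)]
  nlinarith

lemma tendsto_nrm_of_dotProduct_self {v : ℕ → ι → ℝ}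
    (h : Tendsto (fun k => v k ⬝ᵥ v k) atTop (nhds 0)) :
    Tendsto (fun k => nrm (v k)) atTop (nhds 0) := by
  simpa [nrm] using h.sqrt

lemma exists_bound_of_shift {v : ℕ → ι → ℝ} {R : ℝ} (h : ∀ k, nrm (v (k + 2)) ≤ R) :
    ∃ R', ∀ k, nrm (v k) ≤ R' := by
  refine ⟨max R (max (nrm (v 0)) (nrm (v 1))), ?_⟩
  rintro (_ | _ | k)
  · simp
  · simp
  · exact (h k).trans (le_max_left _ _)

lemma tendsto_zero_of_nrm {v : ℕ → ι → ℝ}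
    (h : Tendsto (fun k => nrm (v k)) atTop (nhds 0)) : Tendsto v atTop (nhds 0) := by
  rw [tendsto_pi_nhds]
  intro i
  exact squeeze_zero_norm (fun k => abs_apply_le_nrm (v k) i) h

end QuadraticForms

section ConvexAnalysis

variable {ι : Type*} [Fintype ι]

/-- A minimizer of `f + ½‖· - x‖²_M` for strongly convex `f` satisfies the quadratic-growth
form of the optimality condition `M (x - p) ∈ ∂f(p)`. -/
lemma IsProxPt.strong_subgrad {f : (ι → ℝ) → EReal} {μ : ℝ} (hfp : ProperE f)
    (hfsc : StrongConvexE μ f) {M : Matrix ι ι ℝ} (hM : M.PosDef) {x p : ι → ℝ}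
    (h : IsProxPt M f x p) :
    f p ≠ ⊤ ∧ ∀ w, f w ≠ ⊤ →
      (f p).toReal + (w - p) ⬝ᵥ M *ᵥ (x - p) + μ / 2 * ((w - p) ⬝ᵥ (w - p)) ≤ (f w).toReal := by
  obtain ⟨⟨w₀, hw₀⟩, hbot⟩ := hfp
  have hp : f p ≠ ⊤ := by
    intro hp
    have h1 := h w₀
    rw [hp, EReal.top_add_coe, top_le_iff, ← EReal.coe_toReal hw₀ (hbot w₀),
      ← EReal.coe_add] at h1
    exact EReal.coe_ne_top _ h1
  refine ⟨hp, fun w hw => ?_⟩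
  have key : ∀ t ∈ Set.Ioo (0 : ℝ) 1,
      (f p).toReal + (w - p) ⬝ᵥ M *ᵥ (x - p) + μ / 2 * (1 - t) * ((w - p) ⬝ᵥ (w - p))
        - t / 2 * ((w - p) ⬝ᵥ M *ᵥ (w - p)) ≤ (f w).toReal := by
    intro t ht
    have h1 := hfsc w p t ht.1.le ht.2.le
    have h2 := h (t • w + (1 - t) • p)
    generalize hq : t • w + (1 - t) • p = q at h1 h2
    rw [← EReal.coe_toReal hp (hbot p), ← EReal.coe_toReal hw (hbot w)] at h1
    have hqt : f q ≠ ⊤ := by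
      intro hqt
      rw [hqt, EReal.top_add_coe, top_le_iff] at h1
      exact EReal.coe_ne_top _ (by exact_mod_cast h1)
    rw [← EReal.coe_toReal hqt (hbot q)] at h1 h2
    rw [← EReal.coe_toReal hp (hbot p)] at h2
    have h1' : (f q).toReal + μ / 2 * (t * (1 - t)) * ((w - p) ⬝ᵥ (w - p)) ≤
        t * (f w).toReal + (1 - t) * (f p).toReal := by exact_mod_cast h1
    have h2' : (f p).toReal + 1 / 2 * ((p - x) ⬝ᵥ M *ᵥ (p - x)) ≤
        (f q).toReal + 1 / 2 * ((q - x) ⬝ᵥ M *ᵥ (q - x)) := by exact_mod_cast h2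
    have hqx : q - x = t • (w - p) + -(x - p) := by rw [← hq]; module
    have hpx : p - x = -(x - p) := by module
    rw [hqx, hpx] at h2'
    have h3 := hM.dotProduct_mulVec_comm_real (x - p) (w - p)
    generalize w - p = a at *
    generalize x - p = b at *
    simp only [mulVec_add, mulVec_neg, mulVec_smul, add_dotProduct, dotProduct_add,
      neg_dotProduct, dotProduct_neg, smul_dotProduct, dotProduct_smul, smul_eq_mul, h3] at h2'
    refine le_of_mul_le_mul_left (a := t) ?_ ht.1
    nlinarith
  have hlim : Tendsto (fun t : ℝ => (f p).toReal + (w - p) ⬝ᵥ M *ᵥ (x - p)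
      + μ / 2 * (1 - t) * ((w - p) ⬝ᵥ (w - p)) - t / 2 * ((w - p) ⬝ᵥ M *ᵥ (w - p)))
      (nhdsWithin 0 (Set.Ioi 0))
      (nhds ((f p).toReal + (w - p) ⬝ᵥ M *ᵥ (x - p) + μ / 2 * ((w - p) ⬝ᵥ (w - p)))) := by
    refine Tendsto.mono_left ?_ nhdsWithin_le_nhds
    refine Continuous.tendsto' (by fun_prop) _ _ (by ring)
  refine le_of_tendsto hlim ?_
  filter_upwards [Ioo_mem_nhdsGT (zero_lt_one (α := ℝ))] with t ht using key t ht

lemma lowerSemicontinuous_conjE (g : (ι → ℝ) → EReal) : LowerSemicontinuous (conjE g) := by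
  refine lowerSemicontinuous_iSup fun w => Continuous.lowerSemicontinuous ?_
  rcases eq_or_ne (g w) ⊤ with h | h
  · simpa [h] using continuous_const
  rcases eq_or_ne (g w) ⊥ with h' | h'
  · simpa [h'] using continuous_const
  rw [← EReal.coe_toReal h h']
  have : Continuous fun y : ι → ℝ => ((w ⬝ᵥ y - (g w).toReal : ℝ) : EReal) :=
    continuous_coe_real_ereal.comp (by fun_prop)
  simpa using this

lemma coe_dotProduct_sub_le_conjE (f : (ι → ℝ) → EReal) (w y : ι → ℝ) :
    ((w ⬝ᵥ y : ℝ) : EReal) - f w ≤ conjE f y :=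
  le_iSup (fun x : ι → ℝ => ((x ⬝ᵥ y : ℝ) : EReal) - f x) w

/-- The graph of the subdifferential of a lower semicontinuous function is closed. -/
lemma SubgradAt.of_tendsto {f : (ι → ℝ) → EReal} (hf : LowerSemicontinuous f)
    {x v : ℕ → ι → ℝ} {X V : ι → ℝ} (hx : Tendsto x atTop (nhds X))
    (hv : Tendsto v atTop (nhds V)) (h : ∀ k, SubgradAt f (x k) (v k)) :
    SubgradAt f X V := by
  intro w
  have hd : Tendsto (fun k => (w - x k) ⬝ᵥ v k) atTop (nhds ((w - X) ⬝ᵥ V)) :=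
    tendsto_finsetSum _ fun i _ =>
      ((tendsto_pi_nhds.mp hx i).const_sub (w i)).mul (tendsto_pi_nhds.mp hv i)
  have hd' : Tendsto (fun k => f w - (((w - x k) ⬝ᵥ v k : ℝ) : EReal)) atTop
      (nhds (f w - (((w - X) ⬝ᵥ V : ℝ) : EReal))) := by
    induction f w with
    | bot => simp only [EReal.bot_sub, tendsto_const_nhds]
    | top => simp only [EReal.top_sub_coe, tendsto_const_nhds]
    | coe r =>
      have := (continuous_coe_real_ereal.tendsto _).comp (hd.const_sub r)
      simpa only [Function.comp_def, EReal.coe_sub] using this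
  have hle : ∀ k, f (x k) ≤ f w - (((w - x k) ⬝ᵥ v k : ℝ) : EReal) := fun k =>
    EReal.le_sub_iff_add_le (.inl (EReal.coe_ne_bot _)) (.inl (EReal.coe_ne_top _)) |>.mpr (h k w)
  have hX : f X ≤ f w - (((w - X) ⬝ᵥ V : ℝ) : EReal) := by
    by_contra! hcon
    obtain ⟨c, hc₁, hc₂⟩ := exists_between hcon
    obtain ⟨k, hk₁, hk₂⟩ :=
      ((hd'.eventually_lt_const hc₁).and (hx.eventually (hf X c hc₂))).exists
    exact absurd (hk₁.trans hk₂) (hle k).not_gt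
  exact EReal.le_sub_iff_add_le (.inl (EReal.coe_ne_bot _)) (.inl (EReal.coe_ne_top _)) |>.mp hX

end ConvexAnalysis

section Finiteness

variable {ι : Type*} [Fintype ι]

lemma SubgradAt.ne_top {f : (ι → ℝ) → EReal} {x v : ι → ℝ} (h : SubgradAt f x v)
    (hf : ∃ w, f w ≠ ⊤) : f x ≠ ⊤ := by
  obtain ⟨w, hw⟩ := hf
  intro hx
  have := h w
  rw [hx, EReal.top_add_coe, top_le_iff] at this
  exact hw this

lemma conjE_ne_bot {f : (ι → ℝ) → EReal} (hf : ∃ w, f w ≠ ⊤) (v : ι → ℝ) : conjE f v ≠ ⊥ := by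
  obtain ⟨w, hw⟩ := hf
  intro h
  have := coe_dotProduct_sub_le_conjE f w v
  rw [h, le_bot_iff, sub_eq_add_neg, EReal.add_eq_bot_iff] at this
  simp [hw] at this

lemma conjE_le_coe {f : (ι → ℝ) → EReal} (hf : ∀ w, f w ≠ ⊥) {v : ι → ℝ} {a : ℝ}
    (h : ∀ w, f w ≠ ⊤ → w ⬝ᵥ v - (f w).toReal ≤ a) : conjE f v ≤ a := by
  refine iSup_le fun w => ?_
  by_cases hw : f w = ⊤
  · simp [hw]
  · rw [← EReal.coe_toReal hw (hf w)]
    exact_mod_cast h w hw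

lemma SubgradAt.conjE_ne_top {f : (ι → ℝ) → EReal} {x v : ι → ℝ} (h : SubgradAt f x v)
    (hf : ∀ w, f w ≠ ⊥) (hx : f x ≠ ⊤) : conjE f v ≠ ⊤ := by
  refine ne_top_of_le_ne_top (EReal.coe_ne_top (x ⬝ᵥ v - (f x).toReal))
    (conjE_le_coe hf fun w hw => ?_)
  have := h w
  rw [← EReal.coe_toReal hw (hf w), ← EReal.coe_toReal hx (hf x)] at this
  have h' : (f x).toReal + (w - x) ⬝ᵥ v ≤ (f w).toReal := by exact_mod_cast this
  rw [sub_dotProduct] at h'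
  linarith

end Finiteness

/-- The stepsize condition `½M⁻¹ ≻ (‖M‖/μ²)I` forces `μM⁻¹ ⪰ I`. -/
lemma dotProduct_self_le_mul_inv {ι : Type*} [Fintype ι] [DecidableEq ι] {M : Matrix ι ι ℝ}
    (hM : M.PosDef) {μ : ℝ} (hμ : 0 < μ)
    (hC : ((1 / 2 : ℝ) • M⁻¹ - (specNorm M / μ ^ 2) • (1 : Matrix ι ι ℝ)).PosDef)
    (v : ι → ℝ) : v ⬝ᵥ v ≤ μ * (v ⬝ᵥ M⁻¹ *ᵥ v) := by
  have h1 := hM.mulVec_dotProduct_mulVec_le (M⁻¹ *ᵥ v)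
  rw [hM.mulVec_inv_mulVec, dotProduct_comm (M⁻¹ *ᵥ v)] at h1
  have h2 := hC.dotProduct_mulVec_nonneg_real v
  simp only [sub_mulVec, smul_mulVec, one_mulVec, dotProduct_sub, dotProduct_smul,
    smul_eq_mul] at h2
  have h0 := dotProduct_self_nonneg' v
  have hq := hM.inv.dotProduct_mulVec_nonneg_real v
  have hs := specNorm_nonneg M
  generalize v ⬝ᵥ v = a at *
  generalize v ⬝ᵥ M⁻¹ *ᵥ v = q at *
  generalize specNorm M = σ at *
  have h3 : 2 * σ * a ≤ μ ^ 2 * q := by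
    have : σ / μ ^ 2 * a = σ * a / μ ^ 2 := by ring
    rw [this, sub_nonneg, div_le_iff₀ (by positivity)] at h2
    linarith
  refine le_of_sq_le_sq ?_ (by positivity)
  nlinarith [mul_le_mul_of_nonneg_right h1 h0, mul_le_mul_of_nonneg_right h3 hq, sq_nonneg a]

/-- A sequence bounded below that decreases by at least `d k ≥ 0` at each step has `d k → 0`. -/
lemma tendsto_zero_of_le_sub {L d : ℕ → ℝ} {B : ℝ} (hL : ∀ k, B ≤ L k) (hd : ∀ k, 0 ≤ d k)
    (h : ∀ k, L (k + 1) ≤ L k - d k) : Antitone L ∧ Tendsto d atTop (nhds 0) := by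
  have hanti : Antitone L := antitone_nat_of_succ_le fun k => by linarith [h k, hd k]
  refine ⟨hanti, ?_⟩
  have hlim := tendsto_atTop_ciInf hanti ⟨B, by rintro _ ⟨k, rfl⟩; exact hL k⟩
  have hdiff := hlim.sub (hlim.comp (tendsto_add_atTop_nat 1))
  rw [sub_self] at hdiff
  exact squeeze_zero hd (fun k => by simp only [Function.comp]; linarith [h k]) hdiff

/-- subsequential convergence of inexact PrePDHG.  Under strong convexity
of `f`, existence of a primal-dual solution pair, coercivity of the dual objective
`z ↦ g*(z) + f*(−Aᵀz)`, and `C1 ≻ 0`, `C2 ≻ 0`, the iterates `(x^k, z^k)` of inexact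
PrePDHG are bounded and every cluster point is a primal-dual solution pair. -/
theorem inexact_prePDHG_subsequential_convergence {n m : ℕ}
    (f : (Fin n → ℝ) → EReal) (g : (Fin m → ℝ) → EReal)
    (μ : ℝ) (hμ : 0 < μ)
    (hfp : ProperE f) (hfc : LowerSemicontinuous f) (hfsc : StrongConvexE μ f)
    (hgp : ProperE g) (hgc : LowerSemicontinuous g) (hgv : ConvexE g)
    (A : Matrix (Fin m) (Fin n) ℝ)
    (hsol : ∃ (xs : Fin n → ℝ) (zs : Fin m → ℝ),
      SubgradAt f xs (-(Aᵀ.mulVec zs)) ∧ SubgradAt g (A.mulVec xs) zs)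
    (hcoercive : ∀ C : ℝ, ∃ R : ℝ, ∀ v : Fin m → ℝ, R < nrm v →
      (C : EReal) < conjE g v + conjE f (-(Aᵀ.mulVec v)))
    (M1 : Matrix (Fin n) (Fin n) ℝ) (M2 : Matrix (Fin m) (Fin m) ℝ)
    (hM1 : M1.PosDef) (hM2 : M2.PosDef)
    (c : ℝ) (hc : 0 < c)
    (hC1 : ((1 / 2 : ℝ) • M1⁻¹ -
      (specNorm M1 / μ ^ 2) • (1 : Matrix (Fin n) (Fin n) ℝ)).PosDef)
    (hC2 : (M2 - (1 / 2 : ℝ) • (A * M1⁻¹ * Aᵀ) -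
      c • (1 : Matrix (Fin m) (Fin m) ℝ)).PosDef)
    (x : ℕ → Fin n → ℝ) (z : ℕ → Fin m → ℝ) (ε : ℕ → Fin m → ℝ)
    (hx : ∀ k, IsProxPt M1 f (x k - M1⁻¹.mulVec (Aᵀ.mulVec (z k))) (x (k + 1)))
    (hz : ∀ k, SubgradAt (conjE g) (z (k + 1))
      (-(M2.mulVec (z (k + 1) - z k -
        M2⁻¹.mulVec (A.mulVec ((2 : ℝ) • x (k + 1) - x k)))) - ε (k + 1)))
    (hε : ∀ k, nrm (ε (k + 1)) ≤ c * nrm (z (k + 1) - z k)) :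
    (∃ R : ℝ, ∀ k, nrm (x k) ≤ R ∧ nrm (z k) ≤ R) ∧
    (∀ (X : Fin n → ℝ) (Z : Fin m → ℝ),
      (∃ φ : ℕ → ℕ, StrictMono φ ∧
        Tendsto (fun j => (x (φ j), z (φ j))) atTop (nhds (X, Z))) →
      SubgradAt f X (-(Aᵀ.mulVec Z)) ∧ SubgradAt (conjE g) Z (A.mulVec X)) := by

  obtain ⟨xs, zs, hxs, hzs⟩ := hsol
  set y : ℕ → Fin n → ℝ := fun k => -(Aᵀ *ᵥ z k) with hy
  set u : ℕ → Fin n → ℝ := fun k => y k - M1 *ᵥ (x (k + 1) - x k) with hu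
  set s : ℕ → Fin m → ℝ := fun k =>
    A *ᵥ ((2 : ℝ) • x (k + 1) - x k) - M2 *ᵥ (z (k + 1) - z k) - ε (k + 1) with hs
  have hu' : ∀ k, M1 *ᵥ (x k - M1⁻¹ *ᵥ (Aᵀ *ᵥ z k) - x (k + 1)) = u k := by
    intro k
    simp only [hu, hy, mulVec_sub, hM1.mulVec_inv_mulVec]
    abel
  have hzs' : ∀ k, SubgradAt (conjE g) (z (k + 1)) (s k) := by
    intro k
    convert hz k using 1
    simp only [hs, mulVec_sub, hM2.mulVec_inv_mulVec]
    abel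
  -- finiteness of the function values along the iterates and at the solution
  have hfxs : f xs ≠ ⊤ := hxs.ne_top hfp.1
  have hgAxs : g (A *ᵥ xs) ≠ ⊤ := hzs.ne_top hgp.1
  have hconj_bot : ∀ v, conjE g v ≠ ⊥ := conjE_ne_bot hgp.1
  have hconj_top : ∀ k, conjE g (z (k + 1)) ≠ ⊤ := fun k =>
    (hzs' k).ne_top ⟨zs, hzs.conjE_ne_top hgp.2 hgAxs⟩
  have hft : ∀ k, f (x (k + 1)) ≠ ⊤ := fun k => ((hx k).strong_subgrad hfp hfsc hM1).1
  set F : ℕ → ℝ := fun k => (f (x (k + 1))).toReal with hF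
  set G : ℕ → ℝ := fun k => (conjE g (z (k + 1))).toReal with hG
  have hstrong : ∀ k w, f w ≠ ⊤ →
      F k + (w - x (k + 1)) ⬝ᵥ u k + μ / 2 * ((w - x (k + 1)) ⬝ᵥ (w - x (k + 1))) ≤
        (f w).toReal := by
    intro k w hw
    have := ((hx k).strong_subgrad hfp hfsc hM1).2 w hw
    rwa [hu'] at this
  have hlip : ∀ k l, μ * nrm (x (l + 1) - x (k + 1)) ≤ nrm (u l - u k) := by
    intro k l
    have h1 := hstrong k _ (hft l)
    have h2 := hstrong l _ (hft k)
    have h3 : x (k + 1) - x (l + 1) = -(x (l + 1) - x (k + 1)) := by abel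
    rw [h3] at h2
    have h4 := dotProduct_le_nrm_mul_nrm (x (l + 1) - x (k + 1)) (u l - u k)
    simp only [neg_dotProduct, dotProduct_neg, dotProduct_sub _ (u l), ← nrm_sq, neg_neg]
      at h1 h2 h4
    rcases (nrm_nonneg (x (l + 1) - x (k + 1))).eq_or_lt with h | h
    · rw [← h, mul_zero]
      exact nrm_nonneg _
    · refine le_of_mul_le_mul_left (a := nrm (x (l + 1) - x (k + 1))) ?_ h
      simp only [hF] at h1 h2
      linarith
  have hGdesc : ∀ k, G (k + 1) + (z (k + 1) - z (k + 2)) ⬝ᵥ s (k + 1) ≤ G k := by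
    intro k
    have := hzs' (k + 1) (z (k + 1))
    rw [← EReal.coe_toReal (hconj_top k) (hconj_bot _),
      ← EReal.coe_toReal (hconj_top (k + 1)) (hconj_bot _)] at this
    exact_mod_cast this
  set L : ℕ → ℝ := fun k => G k + x (k + 1) ⬝ᵥ y (k + 1) - F k +
    1 / 2 * ((y (k + 1) - u k) ⬝ᵥ M1⁻¹ *ᵥ (y (k + 1) - u k)) with hL
  -- sufficient decrease of the augmented Lagrangian
  have hdesc : ∀ k, L (k + 1) ≤ L k -
      ((u (k + 1) - u k) ⬝ᵥ ((1 / 2 : ℝ) • M1⁻¹ -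
        (specNorm M1 / μ ^ 2) • (1 : Matrix (Fin n) (Fin n) ℝ)) *ᵥ (u (k + 1) - u k) +
      (z (k + 2) - z (k + 1)) ⬝ᵥ (M2 - (1 / 2 : ℝ) • (A * M1⁻¹ * Aᵀ) -
        c • (1 : Matrix (Fin m) (Fin m) ℝ)) *ᵥ (z (k + 2) - z (k + 1))) := by
    intro k
    have h2 := hGdesc k
    have h3 := hlip k (k + 1)
    obtain ⟨dx, hdx⟩ : ∃ dx, dx = x (k + 2) - x (k + 1) := ⟨_, rfl⟩
    obtain ⟨dz, hdz⟩ : ∃ dz, dz = z (k + 2) - z (k + 1) := ⟨_, rfl⟩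
    obtain ⟨du, hdu⟩ : ∃ du, du = u (k + 1) - u k := ⟨_, rfl⟩
    obtain ⟨dy, hdy⟩ : ∃ dy, dy = y (k + 2) - y (k + 1) := ⟨_, rfl⟩
    have h1 : F k + dx ⬝ᵥ u k + μ / 2 * (dx ⬝ᵥ dx) ≤ F (k + 1) := by
      rw [hdx]
      exact hstrong k _ (hft (k + 1))
    have hdyA : dy = -(Aᵀ *ᵥ dz) := by
      simp only [hdy, hdz, hy, mulVec_sub]; abel
    have hAdot : ∀ w, dz ⬝ᵥ A *ᵥ w = -(dy ⬝ᵥ w) := by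
      intro w
      rw [hdyA, dotProduct_mulVec, neg_dotProduct, neg_neg, mulVec_transpose]
    have hr : y (k + 1) - u k = M1 *ᵥ dx + du := by
      simp only [hdu, hdx, hu]; abel
    have hr' : y (k + 2) - u (k + 1) = M1 *ᵥ dx + dy := by
      simp only [hdy, hdx, hu]; abel
    have hyk : y (k + 1) = u k + (M1 *ᵥ dx + du) := by rw [← hr]; abel
    have hyk' : y (k + 2) = y (k + 1) + dy := by rw [hdy]; abel
    have hxk : x (k + 2) = x (k + 1) + dx := by rw [hdx]; abel
    have hquad : ∀ w : Fin n → ℝ, (M1 *ᵥ dx + w) ⬝ᵥ M1⁻¹ *ᵥ (M1 *ᵥ dx + w) =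
        dx ⬝ᵥ M1 *ᵥ dx + 2 * (dx ⬝ᵥ w) + w ⬝ᵥ M1⁻¹ *ᵥ w := by
      intro w
      have := hM1.inv.dotProduct_mulVec_comm_real (M1 *ᵥ dx) w
      simp only [mulVec_add, hM1.inv_mulVec_mulVec, add_dotProduct, dotProduct_add, this, dotProduct_comm w dx,
        dotProduct_comm (M1 *ᵥ dx) dx]
      ring
    have h4 := dotProduct_mulVec_le_specNorm M1 dx
    have h5 : specNorm M1 * (dx ⬝ᵥ dx) ≤ specNorm M1 / μ ^ 2 * (du ⬝ᵥ du) := by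
      have h := pow_le_pow_left₀ (mul_nonneg hμ.le (nrm_nonneg _)) h3 2
      rw [mul_pow, nrm_sq, nrm_sq, ← hdu, ← hdx] at h
      rw [div_mul_eq_mul_div, le_div_iff₀ (by positivity)]
      nlinarith [mul_le_mul_of_nonneg_left h (specNorm_nonneg M1)]
    have h6 : -(dz ⬝ᵥ ε (k + 2)) ≤ c * (dz ⬝ᵥ dz) := by
      have h := dotProduct_le_nrm_mul_nrm dz (-ε (k + 2))
      have h' := mul_le_mul_of_nonneg_left (hε (k + 1)) (nrm_nonneg dz)
      rw [nrm_neg, dotProduct_neg] at h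
      rw [← hdz] at h'
      rw [← nrm_sq]
      nlinarith
    have hAPA : dz ⬝ᵥ (A * M1⁻¹ * Aᵀ) *ᵥ dz = dy ⬝ᵥ M1⁻¹ *ᵥ dy := by
      rw [← mulVec_mulVec, ← mulVec_mulVec, hAdot, hdyA, mulVec_neg, dotProduct_neg]
    have hsk : s (k + 1) = A *ᵥ (x (k + 1) + dx + dx) - M2 *ᵥ dz - ε (k + 2) := by
      simp only [hs, hdz, hdx]
      congr 3
      module
    have hzneg : z (k + 1) - z (k + 2) = -dz := by rw [hdz]; abel
    rw [hzneg, hsk] at h2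
    have h7 := dotProduct_self_nonneg' dx
    rw [← hdz, ← hdu]
    change G (k + 1) + x (k + 2) ⬝ᵥ y (k + 2) - F (k + 1) +
      1 / 2 * ((y (k + 2) - u (k + 1)) ⬝ᵥ M1⁻¹ *ᵥ (y (k + 2) - u (k + 1))) ≤
      G k + x (k + 1) ⬝ᵥ y (k + 1) - F k +
      1 / 2 * ((y (k + 1) - u k) ⬝ᵥ M1⁻¹ *ᵥ (y (k + 1) - u k)) - _
    rw [hr, hr', hquad, hquad, hyk', hxk]
    simp only [sub_mulVec, smul_mulVec, one_mulVec, dotProduct_sub, dotProduct_smul, smul_eq_mul,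
      hAPA, neg_dotProduct, hAdot, dotProduct_add, add_dotProduct, dotProduct_comm dy dx,
      dotProduct_comm dy (x (k + 1))] at h2 ⊢
    have h8 : dx ⬝ᵥ y (k + 1) = dx ⬝ᵥ u k + (dx ⬝ᵥ M1 *ᵥ dx + dx ⬝ᵥ du) := by
      rw [hyk, dotProduct_add, dotProduct_add]
    have h9 := mul_nonneg hμ.le h7
    linarith
  have hlow : ∀ k, conjE g (z (k + 1)) + conjE f (y (k + 1)) ≤ (L k : EReal) := by
    intro k
    have h : conjE f (y (k + 1)) ≤ ((x (k + 1) ⬝ᵥ y (k + 1) - F k +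
        1 / 2 * ((y (k + 1) - u k) ⬝ᵥ M1⁻¹ *ᵥ (y (k + 1) - u k)) : ℝ) : EReal) := by
      refine conjE_le_coe hfp.2 fun w hw => ?_
      have h1 := hstrong k w hw
      have h2 := dotProduct_self_le_mul_inv hM1 hμ hC1 (y (k + 1) - u k)
      obtain ⟨e, he⟩ : ∃ e, e = w - x (k + 1) := ⟨_, rfl⟩
      obtain ⟨r, hr⟩ : ∃ r, r = y (k + 1) - u k := ⟨_, rfl⟩
      have h3 := dotProduct_self_nonneg' (r - μ • e)
      have hw' : w = x (k + 1) + e := by rw [he]; abel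
      have hyr : y (k + 1) = u k + r := by rw [hr]; abel
      have h4 : e ⬝ᵥ y (k + 1) = e ⬝ᵥ u k + e ⬝ᵥ r := by rw [hyr, dotProduct_add]
      rw [← hr] at h2 ⊢
      rw [← he] at h1
      have h5 : w ⬝ᵥ y (k + 1) = x (k + 1) ⬝ᵥ y (k + 1) + e ⬝ᵥ y (k + 1) := by
        rw [hw', add_dotProduct]
      simp only [sub_dotProduct, dotProduct_sub, smul_dotProduct, dotProduct_smul, smul_eq_mul,
        dotProduct_comm r e] at h3
      have h6 : e ⬝ᵥ r ≤ μ / 2 * (e ⬝ᵥ e) + 1 / 2 * (r ⬝ᵥ M1⁻¹ *ᵥ r) :=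
        le_of_mul_le_mul_left (a := μ) (by nlinarith) hμ
      linarith
    have h' := add_le_add_right h (conjE g (z (k + 1)))
    rw [← EReal.coe_toReal (hconj_top k) (hconj_bot _), ← EReal.coe_add] at h'
    rw [← EReal.coe_toReal (hconj_top k) (hconj_bot _)]
    refine h'.trans (EReal.coe_le_coe_iff.mpr ?_)
    simp only [hL, hG]
    linarith
  have hbelow : ∀ k, -(g (A *ᵥ xs)).toReal - (f xs).toReal ≤ L k := by
    intro k
    have h := (add_le_add (coe_dotProduct_sub_le_conjE g (A *ᵥ xs) (z (k + 1)))
      (coe_dotProduct_sub_le_conjE f xs (y (k + 1)))).trans (hlow k)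
    rw [← EReal.coe_toReal hfxs (hfp.2 _), ← EReal.coe_toReal hgAxs (hgp.2 _)] at h
    have h' : (A *ᵥ xs) ⬝ᵥ z (k + 1) - (g (A *ᵥ xs)).toReal +
        (xs ⬝ᵥ y (k + 1) - (f xs).toReal) ≤ L k := by exact_mod_cast h
    have h2 : xs ⬝ᵥ y (k + 1) = -((A *ᵥ xs) ⬝ᵥ z (k + 1)) := by
      simp only [hy, dotProduct_neg]
      rw [mulVec_transpose, dotProduct_comm, ← dotProduct_mulVec, dotProduct_comm]
    linarith
  obtain ⟨δ₁, hδ₁, hq₁⟩ := hC1.exists_pos_mul_le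
  obtain ⟨δ₂, hδ₂, hq₂⟩ := hC2.exists_pos_mul_le
  have hnn₁ : ∀ k, 0 ≤ δ₁ * ((u (k + 1) - u k) ⬝ᵥ (u (k + 1) - u k)) := fun k =>
    mul_nonneg hδ₁.le (dotProduct_self_nonneg' _)
  have hnn₂ : ∀ k, 0 ≤ δ₂ * ((z (k + 2) - z (k + 1)) ⬝ᵥ (z (k + 2) - z (k + 1))) := fun k =>
    mul_nonneg hδ₂.le (dotProduct_self_nonneg' _)
  obtain ⟨hanti, hlim⟩ := tendsto_zero_of_le_sub hbelow (fun k => add_nonneg (hnn₁ k) (hnn₂ k))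
    fun k => (hdesc k).trans (sub_le_sub_left (add_le_add (hq₁ _) (hq₂ _)) _)
  have hdu : Tendsto (fun k => nrm (u (k + 1) - u k)) atTop (nhds 0) := by
    refine tendsto_nrm_of_dotProduct_self ?_
    have := (squeeze_zero hnn₁ (fun k => le_add_of_nonneg_right (hnn₂ k)) hlim).const_mul δ₁⁻¹
    simpa [hδ₁.ne'] using this
  have hdz : Tendsto (fun k => nrm (z (k + 1) - z k)) atTop (nhds 0) := by
    refine (tendsto_add_atTop_iff_nat 1).mp (tendsto_nrm_of_dotProduct_self ?_)
    have := (squeeze_zero hnn₂ (fun k => le_add_of_nonneg_left (hnn₁ k)) hlim).const_mul δ₂⁻¹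
    simpa [hδ₂.ne'] using this
  have hdx : Tendsto (fun k => nrm (x (k + 1) - x k)) atTop (nhds 0) := by
    refine (tendsto_add_atTop_iff_nat 1).mp ?_
    refine squeeze_zero (fun k => nrm_nonneg _)
      (fun k => (le_inv_mul_iff₀ hμ).mpr (hlip k (k + 1))) ?_
    simpa using hdu.const_mul μ⁻¹
  constructor
  · obtain ⟨R, hR⟩ := hcoercive (L 0)
    have hzR : ∀ k, nrm (z (k + 1)) ≤ R := by
      intro k
      by_contra! hlt
      have h := (hR _ hlt).trans_le (hlow k)
      exact absurd (hanti k.zero_le) (EReal.coe_lt_coe_iff.mp h).not_ge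
    obtain ⟨D, hD⟩ := hdx.bddAbove_range
    obtain ⟨KA, hKA0, hKA⟩ := exists_nrm_mulVec_le Aᵀ
    obtain ⟨KM, hKM0, hKM⟩ := exists_nrm_mulVec_le M1
    have huR : ∀ k, nrm (u (k + 1)) ≤ KA * R + KM * D := by
      intro k
      refine (nrm_sub_le _ _).trans (add_le_add ?_ ?_)
      · simp only [hy, nrm_neg]
        exact (hKA _).trans (mul_le_mul_of_nonneg_left (hzR k) hKA0)
      · exact (hKM _).trans (mul_le_mul_of_nonneg_left (hD ⟨k + 1, rfl⟩) hKM0)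
    have hxR : ∀ k, nrm (x (k + 2)) ≤
        μ⁻¹ * (KA * R + KM * D + nrm (u 0)) + nrm (x 1) := by
      intro k
      have h1 := hlip 0 (k + 1)
      have h2 := (nrm_sub_le (u (k + 1)) (u 0)).trans (add_le_add_left (huR k) _)
      have h3 := (le_inv_mul_iff₀ hμ).mpr (h1.trans h2)
      have h4 := nrm_add_le (x (k + 2) - x 1) (x 1)
      rw [sub_add_cancel] at h4
      exact h4.trans (add_le_add_left h3 _)
    obtain ⟨Rx, hRx⟩ := exists_bound_of_shift hxR
    obtain ⟨Rz, hRz⟩ := exists_bound_of_shift fun k => hzR (k + 1)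
    exact ⟨max Rx Rz, fun k => ⟨(hRx k).trans (le_max_left _ _), (hRz k).trans (le_max_right _ _)⟩⟩
  · rintro X Z ⟨φ, hφ, hlimφ⟩
    have hφt := hφ.tendsto_atTop
    have hX : Tendsto (fun j => x (φ j)) atTop (nhds X) := hlimφ.fst_nhds
    have hZ : Tendsto (fun j => z (φ j)) atTop (nhds Z) := hlimφ.snd_nhds
    have hdx0 : Tendsto (fun j => x (φ j + 1) - x (φ j)) atTop (nhds 0) :=
      (tendsto_zero_of_nrm hdx).comp hφt
    have hdz0 : Tendsto (fun j => z (φ j + 1) - z (φ j)) atTop (nhds 0) :=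
      (tendsto_zero_of_nrm hdz).comp hφt
    have hε0 : Tendsto (fun j => ε (φ j + 1)) atTop (nhds 0) := by
      refine Tendsto.comp (g := fun k => ε (k + 1)) (tendsto_zero_of_nrm ?_) hφt
      exact squeeze_zero (fun k => nrm_nonneg _) hε (by simpa using hdz.const_mul c)
    have hX1 : Tendsto (fun j => x (φ j + 1)) atTop (nhds X) := by
      simpa using hdx0.add hX
    have hZ1 : Tendsto (fun j => z (φ j + 1)) atTop (nhds Z) := by
      simpa using hdz0.add hZ
    have hmul : ∀ {p q : ℕ} (B : Matrix (Fin p) (Fin q) ℝ) {v : ℕ → Fin q → ℝ} {V : Fin q → ℝ},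
        Tendsto v atTop (nhds V) → Tendsto (fun j => B *ᵥ v j) atTop (nhds (B *ᵥ V)) :=
      fun B _ V h => ((by fun_prop : Continuous fun v => B *ᵥ v).tendsto V).comp h
    have hU : Tendsto (fun j => u (φ j)) atTop (nhds (-(Aᵀ *ᵥ Z))) := by
      simpa using (hmul Aᵀ hZ).neg.sub (hmul M1 hdx0)
    have hS : Tendsto (fun j => s (φ j)) atTop (nhds (A *ᵥ X)) := by
      have h2 : (2 : ℝ) • X - X = X := by module
      simpa [h2] using ((hmul A ((hX1.const_smul (2 : ℝ)).sub hX)).sub (hmul M2 hdz0)).sub hε0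
    refine ⟨SubgradAt.of_tendsto hfc hX1 hU fun j w => ?_,
      SubgradAt.of_tendsto (lowerSemicontinuous_conjE g) hZ1 hS fun j => hzs' (φ j)⟩
    by_cases hw : f w = ⊤
    · simp [hw]
    have h1 := hstrong (φ j) w hw
    have h2 := mul_nonneg (half_pos hμ).le (dotProduct_self_nonneg' (w - x (φ j + 1)))
    rw [← EReal.coe_toReal hw (hfp.2 w), ← EReal.coe_toReal (hft (φ j)) (hfp.2 _)]
    exact_mod_cast (le_add_of_nonneg_right h2).trans h1
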